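/- Let g be a finite-dimensional Lie algebra over a field k of characteristic zero and r : g* → g a skew-symmetric linear map, i.e. ξ(rη) = −η(rξ) for all ξ, η ∈ g*. Then the following are equivalent: (i) r satisfies the classical Yang–Baxter equation in cyclic form, i.e. ζ(⁅rξ,rη⁆) + ξ(⁅rη,rζ⁆) + η(⁅rζ,rξ⁆) = 0 for all ξ, η, ζ ∈ g*; (ii) r is a relative Rota-Baxter operator on g with respect to the coadjoint representation, i.e. ⁅rξ, rη⁆ = r( ad*_{rξ}η − ad*_{rη}ξ ) for all ξ, η ∈ g*. -/

import Mathlib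

/-- The coadjoint action of a Lie algebra on its dual: `(ad*_x ξ)(y) = −ξ(⁅x,y⁆)`. -/
def coad (k : Type*) [Field k] (g : Type*) [LieRing g] [LieAlgebra k g]
    (x : g) (ξ : Module.Dual k g) : Module.Dual k g :=
  -(ξ ∘ₗ LieAlgebra.ad k g x)

/-- For a finite-dimensional Lie algebra `g` and a skew-symmetric `r : g* → g`, the
classical Yang–Baxter equation in cyclic form holds iff `r` is a relative Rota–Baxter
operator on `g` with respect to the coadjoint representation. -/
theorem cybe_iff_relative_rota_baxter (k : Type*) [Field k] [CharZero k]
    (g : Type*) [LieRing g] [LieAlgebra k g] [FiniteDimensional k g]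
    (r : Module.Dual k g →ₗ[k] g)
    (hr : ∀ ξ η : Module.Dual k g, ξ (r η) = -η (r ξ)) :
    (∀ ξ η ζ : Module.Dual k g,
        ζ ⁅r ξ, r η⁆ + ξ ⁅r η, r ζ⁆ + η ⁅r ζ, r ξ⁆ = 0) ↔
      (∀ ξ η : Module.Dual k g,
        ⁅r ξ, r η⁆ = r (coad k g (r ξ) η - coad k g (r η) ξ)) := by
  have key : ∀ ξ η ζ : Module.Dual k g,
      ζ (r (coad k g (r ξ) η - coad k g (r η) ξ)) = -(ξ ⁅r η, r ζ⁆) - η ⁅r ζ, r ξ⁆ := by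
    intro ξ η ζ
    rw [hr, ← lie_skew (r ζ) (r ξ)]
    simp only [coad, LinearMap.sub_apply, LinearMap.neg_apply, LinearMap.comp_apply,
      LieAlgebra.ad_apply, map_neg]
    ring
  constructor
  · intro h ξ η
    rw [← sub_eq_zero, ← Module.forall_dual_apply_eq_zero_iff k]
    intro ζ
    rw [map_sub, key]
    linear_combination h ξ η ζ
  · intro h ξ η ζ
    rw [h ξ η, key]
    ring
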